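/- The subspace of ℂ^{F_p^n} consisting of all ψ : F_p^n → ℂ such that (i) for every x ∈ C₁^⊥ and every v ∈ F_p^n, ω^{⟨x,v⟩} · ψ(v) = ψ(v), and (ii) for every y ∈ C₂ and every v ∈ F_p^n, ψ(v − y) = ψ(v), has complex dimension exactly p^L; that is, the stabilizer code defined by the stabilizer with Z-generators indexed by C₁^⊥ and X-generators indexed by C₂ encodes L qudits. -/

import Mathlib

open scoped BigOperators

noncomputable section

/-- Evaluation map: `c ↦ (f_c(α₁), …, f_c(αₙ))` where `f_c(x) = c₁ + c₂ x + ⋯ + c_k x^{k-1}`. -/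
def ev (p k n : ℕ) (α : Fin n → ZMod p) (c : Fin k → ZMod p) : Fin n → ZMod p :=
  fun i => ∑ j : Fin k, c j * α i ^ (j : ℕ)

/-- The evaluation map as a linear map over `F_p`. -/
def evLin (p k n : ℕ) (α : Fin n → ZMod p) :
    (Fin k → ZMod p) →ₗ[ZMod p] (Fin n → ZMod p) where
  toFun := ev p k n α
  map_add' c d := by
    funext i
    simp [ev, add_mul, Finset.sum_add_distrib]
  map_smul' r c := by
    funext i
    simp [ev, Finset.mul_sum, mul_assoc]

/-- `D(0)`: the vectors in `F_p^k` whose first `L` coordinates are zero. -/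
def Dzero (p k L : ℕ) (hLk : L ≤ k) : Submodule (ZMod p) (Fin k → ZMod p) where
  carrier := {c | ∀ i : Fin L, c (Fin.castLE hLk i) = 0}
  add_mem' := fun ha hb i => by simp [Pi.add_apply, ha i, hb i]
  zero_mem' := fun i => rfl
  smul_mem' := fun r c hc i => by simp [Pi.smul_apply, hc i]

/-- The dual code with respect to the standard bilinear form `⟨x,y⟩ = ∑ i, x i * y i`. -/
def dualCode (p n : ℕ) (C : Submodule (ZMod p) (Fin n → ZMod p)) :
    Submodule (ZMod p) (Fin n → ZMod p) where
  carrier := {x | ∀ y ∈ C, ∑ i, x i * y i = 0}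
  add_mem' := by
    intro a b ha hb y hy
    simp only [Pi.add_apply, add_mul, Finset.sum_add_distrib, ha y hy, hb y hy, add_zero]
  zero_mem' := by intro y _; simp
  smul_mem' := by
    intro r x hx y hy
    simp only [Pi.smul_apply, smul_eq_mul, mul_assoc, ← Finset.mul_sum, hx y hy, mul_zero]

/-- The stabilizer code: all `ψ : F_p^n → ℂ` fixed by every Z-generator indexed by
`C1p` and every X-generator indexed by `C2`. -/
def Qspace (p n : ℕ) (ω : ℂ) (C1p C2 : Submodule (ZMod p) (Fin n → ZMod p)) :
    Submodule ℂ ((Fin n → ZMod p) → ℂ) where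
  carrier := {ψ | (∀ x ∈ C1p, ∀ v : Fin n → ZMod p, ω ^ (∑ i, x i * v i).val * ψ v = ψ v) ∧
                  (∀ y ∈ C2, ∀ v : Fin n → ZMod p, ψ (v - y) = ψ v)}
  add_mem' := by
    intro a b ha hb
    constructor
    · intro x hx v
      simp only [Pi.add_apply, mul_add, ha.1 x hx v, hb.1 x hx v]
    · intro y hy v
      simp only [Pi.add_apply, ha.2 y hy v, hb.2 y hy v]
  zero_mem' := by
    constructor
    · intro x _ v; simp
    · intro y _ v; simp
  smul_mem' := by
    intro r ψ hψ
    constructor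
    · intro x hx v
      simp only [Pi.smul_apply, smul_eq_mul]
      rw [mul_left_comm, hψ.1 x hx v]
    · intro y hy v
      simp only [Pi.smul_apply, hψ.2 y hy v]

/-- The dual code separates points outside `C` from `C`. -/
theorem exists_mem_dualCode_of_notMem {p n : ℕ} [Fact p.Prime]
    {C : Submodule (ZMod p) (Fin n → ZMod p)} {v : Fin n → ZMod p} (hv : v ∉ C) :
    ∃ x ∈ dualCode p n C, ∑ i, x i * v i ≠ 0 := by
  obtain ⟨f, hfv, hfC⟩ := Submodule.exists_le_ker_of_notMem hv
  have hf (y : Fin n → ZMod p) : ∑ i, f (Pi.single i 1) * y i = f y := by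
    rw [LinearMap.pi_apply_eq_sum_univ f y]
    refine Finset.sum_congr rfl fun i _ => ?_
    rw [smul_eq_mul, mul_comm]
    congr 2
    ext j
    simp [Pi.single_apply, eq_comm]
  exact ⟨fun i => f (Pi.single i 1), fun y hy => (hf y).trans (hfC hy), by simpa only [hf] using hfv⟩

/-- A function fixed by the Z-generators indexed by `C^⊥` vanishes outside `C`. -/
theorem eq_zero_of_mem_Qspace {p n : ℕ} [Fact p.Prime] {ω : ℂ} (hω : IsPrimitiveRoot ω p)
    {C C₂ : Submodule (ZMod p) (Fin n → ZMod p)} {ψ : (Fin n → ZMod p) → ℂ}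
    (hψ : ψ ∈ Qspace p n ω (dualCode p n C) C₂) {v : Fin n → ZMod p} (hv : v ∉ C) : ψ v = 0 := by
  obtain ⟨x, hx, hxv⟩ := exists_mem_dualCode_of_notMem hv
  by_contra h
  have h1 := mul_right_cancel₀ h ((hψ.1 x hx v).trans (one_mul _).symm)
  have h2 := Nat.eq_zero_of_dvd_of_lt ((hω.pow_eq_one_iff_dvd _).1 h1) (ZMod.val_lt _)
  exact hxv ((ZMod.val_eq_zero _).1 h2)

/-- If `C₁` is the image of an injective map `E` and `C₂` is the image under `E` of the kernel of a
surjective map `π`, then the stabilizer code is isomorphic to the space of functions on the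
codomain of `π`. -/
def qspaceEquiv {p n : ℕ} [Fact p.Prime] {ω : ℂ} (hω : IsPrimitiveRoot ω p)
    {V W : Type*} [AddCommGroup V] [Module (ZMod p) V] [AddCommGroup W] [Module (ZMod p) W]
    (E : V →ₗ[ZMod p] (Fin n → ZMod p)) (hE : Function.Injective E)
    (π : V →ₗ[ZMod p] W) (hπ : Function.Surjective π) :
    Qspace p n ω (dualCode p n (LinearMap.range E)) (Submodule.map E (LinearMap.ker π)) ≃ₗ[ℂ]
      (W → ℂ) where
  toFun ψ s := ψ.1 (E (Function.surjInv hπ s))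
  map_add' _ _ := rfl
  map_smul' _ _ := rfl
  invFun g := ⟨Function.extend E (g ∘ π) 0, by
    refine ⟨fun x hx v => ?_, ?_⟩
    · by_cases hv : ∃ c, E c = v
      · rw [hx v hv, ZMod.val_zero, pow_zero, one_mul]
      · rw [Function.extend_apply' _ _ _ hv, Pi.zero_apply, mul_zero]
    · rintro _ ⟨d, hd, rfl⟩ v
      by_cases hv : ∃ c, E c = v
      · obtain ⟨c, rfl⟩ := hv
        rw [← map_sub, hE.extend_apply, hE.extend_apply]
        simp [LinearMap.mem_ker.1 hd]
      · rw [Function.extend_apply' _ _ _ hv, Function.extend_apply']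
        · rfl
        · rintro ⟨c, hc⟩
          exact hv ⟨c + d, by rw [map_add, hc, sub_add_cancel]⟩⟩
  left_inv ψ := by
    ext v
    by_cases hv : ∃ c, E c = v
    · obtain ⟨c, rfl⟩ := hv
      have hker : c - Function.surjInv hπ (π c) ∈ LinearMap.ker π := by
        simp [Function.surjInv_eq hπ]
      have h := ψ.2.2 _ (Submodule.mem_map_of_mem hker) (E c)
      rw [← map_sub, sub_sub_cancel] at h
      exact (hE.extend_apply _ _ c).trans h
    · exact (Function.extend_apply' _ _ _ hv).trans (eq_zero_of_mem_Qspace hω ψ.2 hv).symm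
  right_inv g := by
    ext s
    change Function.extend E (g ∘ π) 0 (E (Function.surjInv hπ s)) = g s
    rw [hE.extend_apply, Function.comp_apply, Function.surjInv_eq hπ]

/-- A polynomial of degree less than `k` is determined by its values at `n ≥ k` distinct points. -/
theorem evLin_injective {p k n : ℕ} [Fact p.Prime] (hkn : k ≤ n) {α : Fin n → ZMod p}
    (hα : Function.Injective α) : Function.Injective (evLin p k n α) := by
  refine (injective_iff_map_eq_zero _).2 fun c hc => ?_
  exact Matrix.eq_zero_of_forall_index_sum_mul_pow_eq_zero
    (hα.comp (Fin.castLE_injective hkn)) fun j => congrFun hc (Fin.castLE hkn j)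

/-- `D(0)` is the kernel of the projection to the first `L` coordinates. -/
theorem Dzero_eq_ker (p k L : ℕ) (hLk : L ≤ k) :
    Dzero p k L hLk = LinearMap.ker (LinearMap.funLeft (ZMod p) (ZMod p) (Fin.castLE hLk)) := by
  ext c
  exact funext_iff.symm

/-- the stabilizer code with Z-generators indexed by `C₁^⊥` and
X-generators indexed by `C₂` has complex dimension exactly `p^L`,
i.e. it encodes `L` qudits. -/
theorem stabilizer_code_dim (p k L n : ℕ) [Fact p.Prime]
    (hk : 0 < k) (hL : 0 < L) (hn0 : 0 < n) (hLk : L ≤ k)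
    (hn : n = 2 * k - L) (hnp : n < p)
    (α : Fin n → ZMod p) (hαinj : Function.Injective α) (hα0 : ∀ i, α i ≠ 0)
    (ω : ℂ) (hω : ω = Complex.exp (2 * Real.pi * Complex.I / p)) :
    Module.finrank ℂ
      (Qspace p n ω (dualCode p n (LinearMap.range (evLin p k n α)))
        (Submodule.map (evLin p k n α) (Dzero p k L hLk))) = p ^ L := by
  have hprim : IsPrimitiveRoot ω p := hω ▸ Complex.isPrimitiveRoot_exp p (NeZero.ne p)
  rw [Dzero_eq_ker, (qspaceEquiv hprim _ (evLin_injective (by lia) hαinj) _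
    (LinearMap.funLeft_surjective_of_injective _ _ _ (Fin.castLE_injective hLk))).finrank_eq]
  simp [ZMod.card]
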